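/- Let n ≥ 1, let l > 0, κ ≥ 0, and let γ₁, γ₂ : ℝ → ℝⁿ be curves that are differentiable at every point of the interval [0, l] and whose derivatives γ₁′, γ₂′ are κ-Lipschitz on [0, l]. Suppose ε ≥ 0 and ‖γ₁(s) − γ₂(s)‖ ≤ ε for every s ∈ [0, l]. Then for all s₁, s₂ with 0 ≤ s₁ < s₂ ≤ l one has ‖γ₁′(s₁) − γ₂′(s₁)‖ ≤ 2ε/(s₂ − s₁) + κ·(s₂ − s₁). -/

import Mathlib

/-- First-order Taylor estimate: if the derivative of `f` varies from its value at `a` by at most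
`K * (x - a)`, the linear approximation of `f` at `a` has error at most `K / 2 * (b - a) ^ 2`. -/
theorem norm_sub_sub_smul_le_of_norm_deriv_sub_le {E : Type*} [NormedAddCommGroup E]
    [NormedSpace ℝ E] {f f' : ℝ → E} {a b K : ℝ} (hab : a ≤ b)
    (hf : ∀ x ∈ Set.Icc a b, HasDerivAt f (f' x) x)
    (hf' : ∀ x ∈ Set.Icc a b, ‖f' x - f' a‖ ≤ K * (x - a)) :
    ‖f b - f a - (b - a) • f' a‖ ≤ K / 2 * (b - a) ^ 2 := by
  have hderiv : ∀ x ∈ Set.Icc a b,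
      HasDerivAt (fun x => f x - f a - (x - a) • f' a) (f' x - f' a) x := fun x hx => by
    have h := ((hf x hx).sub_const (f a)).sub
      (((hasDerivAt_id x).sub_const a).smul_const (f' a))
    rwa [one_smul] at h
  have hquad : ∀ x, HasDerivAt (fun x => K / 2 * (x - a) ^ 2) (K * (x - a)) x := fun x => by
    have h := (((hasDerivAt_id x).sub_const a).pow 2).const_mul (K / 2)
    refine h.congr_deriv ?_
    simp only [id_eq]
    ring
  exact image_norm_le_of_norm_deriv_right_le_deriv_boundary
    (fun x hx => (hderiv x hx).continuousAt.continuousWithinAt)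
    (fun x hx => (hderiv x (Set.Ico_subset_Icc_self hx)).hasDerivWithinAt)
    (by simp) hquad (fun x hx => hf' x (Set.Ico_subset_Icc_self hx)) (Set.right_mem_Icc.2 hab)

theorem stmt_1 (n : ℕ) (hn : 1 ≤ n) (l κ ε : ℝ) (hl : 0 < l) (hκ : 0 ≤ κ)
    (γ₁ γ₂ g₁ g₂ : ℝ → EuclideanSpace ℝ (Fin n))
    (hγ₁ : ∀ s ∈ Set.Icc (0:ℝ) l, HasDerivAt γ₁ (g₁ s) s)
    (hγ₂ : ∀ s ∈ Set.Icc (0:ℝ) l, HasDerivAt γ₂ (g₂ s) s)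
    (hg₁ : ∀ s ∈ Set.Icc (0:ℝ) l, ∀ t ∈ Set.Icc (0:ℝ) l, ‖g₁ s - g₁ t‖ ≤ κ * |s - t|)
    (hg₂ : ∀ s ∈ Set.Icc (0:ℝ) l, ∀ t ∈ Set.Icc (0:ℝ) l, ‖g₂ s - g₂ t‖ ≤ κ * |s - t|)
    (hε : 0 ≤ ε)
    (hclose : ∀ s ∈ Set.Icc (0:ℝ) l, ‖γ₁ s - γ₂ s‖ ≤ ε) :
    ∀ s₁ s₂ : ℝ, 0 ≤ s₁ → s₁ < s₂ → s₂ ≤ l →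
      ‖g₁ s₁ - g₂ s₁‖ ≤ 2 * ε / (s₂ - s₁) + κ * (s₂ - s₁) := by
  intro s₁ s₂ h₁ h₁₂ h₂
  have hsub : ∀ x ∈ Set.Icc s₁ s₂, x ∈ Set.Icc (0:ℝ) l :=
    fun x hx => ⟨h₁.trans hx.1, hx.2.trans h₂⟩
  have hs₁ := hsub s₁ (Set.left_mem_Icc.2 h₁₂.le)
  have hs₂ := hsub s₂ (Set.right_mem_Icc.2 h₁₂.le)
  have htaylor := norm_sub_sub_smul_le_of_norm_deriv_sub_le (f := fun x => γ₁ x - γ₂ x)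
    (f' := fun x => g₁ x - g₂ x) (K := 2 * κ) h₁₂.le
    (fun x hx => (hγ₁ x (hsub x hx)).sub (hγ₂ x (hsub x hx))) (fun x hx => by
      have e₁ := hg₁ x (hsub x hx) s₁ hs₁
      have e₂ := hg₂ x (hsub x hx) s₁ hs₁
      rw [abs_of_nonneg (sub_nonneg.2 hx.1)] at e₁ e₂
      calc ‖g₁ x - g₂ x - (g₁ s₁ - g₂ s₁)‖ = ‖(g₁ x - g₁ s₁) - (g₂ x - g₂ s₁)‖ := by
            congr 1; abel
        _ ≤ ‖g₁ x - g₁ s₁‖ + ‖g₂ x - g₂ s₁‖ := norm_sub_le _ _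
        _ ≤ 2 * κ * (x - s₁) := by linarith)
  have hpos : 0 < s₂ - s₁ := sub_pos.2 h₁₂
  have hmul : (s₂ - s₁) * ‖g₁ s₁ - g₂ s₁‖ ≤ 2 * ε + κ * (s₂ - s₁) ^ 2 := by
    rw [← norm_smul_of_nonneg hpos.le]
    have htri := norm_le_norm_add_norm_sub (γ₁ s₂ - γ₂ s₂ - (γ₁ s₁ - γ₂ s₁))
      ((s₂ - s₁) • (g₁ s₁ - g₂ s₁))
    have hdiff := norm_sub_le (γ₁ s₂ - γ₂ s₂) (γ₁ s₁ - γ₂ s₁)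
    linarith [hclose s₁ hs₁, hclose s₂ hs₂]
  rw [div_add' _ _ _ hpos.ne', le_div_iff₀ hpos]
  linarith
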